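/- arXiv:0802.0015 — 3 statements merged into one kernel-verified Lean document; each statement's English description precedes it below -/
import Mathlib

section
/- Let q = 2^t for a positive integer t. For any choice of the set Y, the F_2-span of X0 ∪ Y ∪ {χ_m : m ∈ L1} equals C(P,L); in particular every χ_ℓ with ℓ ∈ L lies in this span. -/
open Submodule Module
open scoped Classical

noncomputable section

variable (k : Type) [Field k] [Fintype k]

/-- The nonsingular alternating bilinear form on `k^4`. -/
def B (u v : Fin 4 → k) : k := u 0 * v 3 - u 3 * v 0 + u 1 * v 2 - u 2 * v 1

/-- Points of the projective space: 1-dimensional subspaces of `k^4`. -/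
def IsPt (p : Submodule k (Fin 4 → k)) : Prop := finrank k p = 1

/-- Lines: totally isotropic 2-dimensional subspaces of `k^4`. -/
def IsLn (l : Submodule k (Fin 4 → k)) : Prop :=
  finrank k l = 2 ∧ ∀ u ∈ l, ∀ v ∈ l, B k u v = 0

/-- The point set `P`. -/
abbrev Pt := {p : Submodule k (Fin 4 → k) // IsPt k p}

def e (i : Fin 4) : Fin 4 → k := Pi.single i 1

/-- The fixed point `p0 = span{e0}`. -/
def p0 : Submodule k (Fin 4 → k) := span k {e k 0}

/-- The fixed line `ℓ0 = span{e0, e1}`. -/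
def l0 : Submodule k (Fin 4 → k) := span k {e k 0, e k 1}

/-- Membership in `P1`: points `span{v}` with `B(e0, v) ≠ 0`. -/
def InP1 (p : Pt k) : Prop := ∃ v ∈ (p : Submodule k (Fin 4 → k)), B k (e k 0) v ≠ 0

/-- The characteristic function of a line, as an `F_2`-valued function on `P`. -/
def chi (l : Submodule k (Fin 4 → k)) : Pt k → ZMod 2 :=
  fun p => if (p : Submodule k (Fin 4 → k)) ≤ l then 1 else 0

/-- The set `L1` of lines meeting `ℓ0` only in `0`. -/
def L1 : Set (Submodule k (Fin 4 → k)) := {l | IsLn k l ∧ l ⊓ l0 k = ⊥}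

/-- The code `C(P,L)`. -/
def CPL : Submodule (ZMod 2) (Pt k → ZMod 2) := span (ZMod 2) (chi k '' {l | IsLn k l})

/-- The code `C(P,L1)`. -/
def CPL1 : Submodule (ZMod 2) (Pt k → ZMod 2) := span (ZMod 2) (chi k '' L1 k)

/-- Restriction of functions on `P` to `P1`. -/
def piP1 : (Pt k → ZMod 2) →ₗ[ZMod 2] ({p : Pt k // InP1 k p} → ZMod 2) :=
  LinearMap.funLeft (ZMod 2) (ZMod 2) Subtype.val

/-- The code `C(P1,L1)`, the image of `C(P,L1)` under restriction to `P1`. -/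
def CP1L1 : Submodule (ZMod 2) ({p : Pt k // InP1 k p} → ZMod 2) := (CPL1 k).map (piP1 k)

/-- `X0`: the characteristic functions of the lines through `p0`, except `χ_{ℓ0}`. -/
def X0 : Set (Pt k → ZMod 2) :=
  (chi k '' {l | IsLn k l ∧ p0 k ≤ l}) \ {chi k (l0 k)}

variable {F : Type} [Field F]

lemma B_add_left (u u' v : Fin 4 → F) : B F (u + u') v = B F u v + B F u' v := by
  simp only [B, Pi.add_apply]; ring

lemma B_add_right (u v v' : Fin 4 → F) : B F u (v + v') = B F u v + B F u v' := by
  simp only [B, Pi.add_apply]; ring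

lemma B_smul_left (r : F) (u v : Fin 4 → F) : B F (r • u) v = r * B F u v := by
  simp only [B, Pi.smul_apply, smul_eq_mul]; ring

lemma B_smul_right (r : F) (u v : Fin 4 → F) : B F u (r • v) = r * B F u v := by
  simp only [B, Pi.smul_apply, smul_eq_mul]; ring

lemma B_self (u : Fin 4 → F) : B F u u = 0 := by
  simp only [B]; ring

lemma B_neg_swap (u v : Fin 4 → F) : B F u v = -B F v u := by
  simp only [B]; ring

variable (F) in
/-- The form `B` as a bilinear form in the sense of Mathlib. -/
def bilinB : LinearMap.BilinForm F (Fin 4 → F) :=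
  LinearMap.mk₂ F (B F) B_add_left B_smul_left B_add_right B_smul_right

@[simp] lemma bilinB_apply (u v : Fin 4 → F) : bilinB F u v = B F u v := rfl

lemma exists_B_ne_zero {a : Fin 4 → F} (ha : a ≠ 0) : ∃ u, B F a u ≠ 0 := by
  by_contra! h
  apply ha
  have h0 := h (Pi.single 3 1)
  have h1 := h (Pi.single 2 1)
  have h2 := h (Pi.single 1 1)
  have h3 := h (Pi.single 0 1)
  simp [B] at h0 h1 h2 h3
  ext i
  fin_cases i <;> simp [*]

lemma bilinB_isRefl : LinearMap.IsRefl (bilinB F) := by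
  intro u v h
  rw [bilinB_apply] at h ⊢
  rw [B_neg_swap, h, neg_zero]

lemma bilinB_nondegenerate : (bilinB F).Nondegenerate := by
  refine bilinB_isRefl.nondegenerate_iff_separatingLeft.2 fun a h => ?_
  by_contra ha
  obtain ⟨u, hu⟩ := exists_B_ne_zero ha
  exact hu (h u)

lemma IsLn.mem_of_orthogonal {l : Submodule F (Fin 4 → F)} (hl : IsLn F l) {v : Fin 4 → F}
    (hv : ∀ u ∈ l, B F u v = 0) : v ∈ l := by
  have h1 : l ≤ (bilinB F).orthogonal l := fun u hu w hw => hl.2 w hw u hu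
  have h2 := LinearMap.BilinForm.finrank_orthogonal bilinB_nondegenerate l
  have h3 : l = (bilinB F).orthogonal l := by
    apply Submodule.eq_of_le_of_finrank_eq h1
    rw [h2, hl.1]
    simp
  rw [h3]
  exact fun u hu => hv u hu

lemma finrank_span_pair {u v : Fin 4 → F} (hli : LinearIndependent F ![u, v]) :
    finrank F (span F {u, v}) = 2 := by
  rw [← Matrix.range_cons_cons_empty u v ![], finrank_span_eq_card hli, Fintype.card_fin]

lemma exists_eq_span_pair {l : Submodule F (Fin 4 → F)} (hl : finrank F l = 2) {a : Fin 4 → F}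
    (ha : a ∈ l) (ha0 : a ≠ 0) : ∃ b, l = span F {a, b} := by
  have hlt : span F {a} < l := by
    refine lt_of_le_of_ne (by simpa [span_le] using ha) fun h => ?_
    have := finrank_span_singleton (K := F) ha0
    rw [h] at this
    omega
  obtain ⟨b, hb, hba⟩ := SetLike.exists_of_lt hlt
  refine ⟨b, ?_⟩
  symm
  apply Submodule.eq_of_le_of_finrank_eq
  · simp [span_le, Set.insert_subset_iff, ha, hb]
  · rw [hl]
    have hli : LinearIndependent F ![a, b] :=
      (LinearIndependent.pair_iff' ha0).2 fun r hr =>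
        hba (hr ▸ smul_mem _ _ (mem_span_singleton_self a))
    exact finrank_span_pair hli

/-- `a, b, c, d` is a symplectic frame, with hyperbolic pairs `(a, d)` and `(b, c)`. -/
structure IsFrame (a b c d : Fin 4 → F) : Prop where
  ab : B F a b = 0
  ac : B F a c = 0
  ad : B F a d = 1
  bc : B F b c = 1
  bd : B F b d = 0
  cd : B F c d = 0

namespace IsFrame

variable {a b c d : Fin 4 → F}

lemma B_comb (h : IsFrame a b c d) (x y z w x' y' z' w' : F) :
    B F (x • a + y • b + z • c + w • d) (x' • a + y' • b + z' • c + w' • d) =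
      x * w' - w * x' + y * z' - z * y' := by
  simp only [B_add_left, B_add_right, B_smul_left, B_smul_right, B_self, B_neg_swap b a,
    B_neg_swap c a, B_neg_swap d a, B_neg_swap c b, B_neg_swap d b, B_neg_swap d c, h.ab, h.ac,
    h.ad, h.bc, h.bd, h.cd]
  ring

lemma eq_zero (h : IsFrame a b c d) {x y z w : F} (h0 : x • a + y • b + z • c + w • d = 0) :
    x = 0 ∧ y = 0 ∧ z = 0 ∧ w = 0 := by
  have key (x' y' z' w' : F) : x * w' - w * x' + y * z' - z * y' = 0 := by
    rw [← h.B_comb, h0]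
    simp [B]
  have h1 := key 0 0 0 1
  have h2 := key 0 0 1 0
  have h3 := key 0 1 0 0
  have h4 := key 1 0 0 0
  simp at h1 h2 h3 h4
  exact ⟨h1, h2, h3, h4⟩

lemma comb_inj (h : IsFrame a b c d) {x y z w x' y' z' w' : F}
    (h0 : x • a + y • b + z • c + w • d = x' • a + y' • b + z' • c + w' • d) :
    x = x' ∧ y = y' ∧ z = z' ∧ w = w' := by
  have := h.eq_zero (x := x - x') (y := y - y') (z := z - z') (w := w - w')
    (by rw [← sub_eq_zero] at h0; rw [← h0]; module)
  simpa only [sub_eq_zero] using this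

lemma linearIndependent (h : IsFrame a b c d) : LinearIndependent F ![a, b, c, d] := by
  rw [Fintype.linearIndependent_iff]
  intro g hg
  simp only [Fin.sum_univ_four] at hg
  obtain ⟨h0, h1, h2, h3⟩ := h.eq_zero hg
  intro i
  fin_cases i <;> assumption

lemma exists_comb (h : IsFrame a b c d) (v : Fin 4 → F) :
    ∃ x y z w : F, v = x • a + y • b + z • c + w • d := by
  have hs := h.linearIndependent.span_eq_top_of_card_eq_finrank (by simp)
  have hv : v ∈ span F (Set.range ![a, b, c, d]) := hs ▸ mem_top
  obtain ⟨g, hg⟩ := (mem_span_range_iff_exists_fun F).1 hv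
  rw [Fin.sum_univ_four] at hg
  exact ⟨g 0, g 1, g 2, g 3, hg.symm⟩

lemma swap (h : IsFrame a b c d) (h2 : (2 : F) = 0) : IsFrame a c b d where
  ab := h.ac
  ac := h.ab
  ad := h.ad
  bc := by rw [B_neg_swap, h.bc]; linear_combination -h2
  bd := h.cd
  cd := h.bd

lemma mem_span_ab (h : IsFrame a b c d) (x y z w : F) :
    x • a + y • b + z • c + w • d ∈ span F {a, b} ↔ z = 0 ∧ w = 0 := by
  rw [mem_span_pair]
  constructor
  · rintro ⟨p, r, hpr⟩
    obtain ⟨-, -, h3, h4⟩ := h.comb_inj (x := p) (y := r) (z := 0) (w := 0)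
      (by rw [← hpr]; module)
    exact ⟨h3.symm, h4.symm⟩
  · rintro ⟨rfl, rfl⟩
    exact ⟨x, y, by module⟩

lemma mem_span_ruling (h : IsFrame a b c d) (s x y z w : F) :
    x • a + y • b + z • c + w • d ∈ span F {s • a + c, s • b + d} ↔ x = s * z ∧ y = s * w := by
  rw [mem_span_pair]
  constructor
  · rintro ⟨p, r, hpr⟩
    obtain ⟨h1, h2, h3, h4⟩ := h.comb_inj (x := p * s) (y := r * s) (z := p) (w := r)
      (by rw [← hpr]; module)
    subst h3 h4
    exact ⟨by rw [← h1, mul_comm], by rw [← h2, mul_comm]⟩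
  · rintro ⟨rfl, rfl⟩
    exact ⟨z, w, by module⟩

end IsFrame

lemma B_eq_zero_of_mem_span_pair {u v : Fin 4 → F} (huv : B F u v = 0) :
    ∀ x ∈ span F {u, v}, ∀ y ∈ span F {u, v}, B F x y = 0 := by
  intro x hx y hy
  obtain ⟨p, r, rfl⟩ := mem_span_pair.1 hx
  obtain ⟨p', r', rfl⟩ := mem_span_pair.1 hy
  simp only [B_add_left, B_add_right, B_smul_left, B_smul_right, B_self, B_neg_swap v u, huv]
  ring

lemma isLn_span_pair {u v : Fin 4 → F} (hli : LinearIndependent F ![u, v])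
    (huv : B F u v = 0) : IsLn F (span F {u, v}) :=
  ⟨finrank_span_pair hli, B_eq_zero_of_mem_span_pair huv⟩

lemma IsFrame.isLn_ab {a b c d : Fin 4 → F} (h : IsFrame a b c d) :
    IsLn F (span F {a, b}) := by
  refine isLn_span_pair ?_ h.ab
  rw [LinearIndependent.pair_iff]
  intro p r hpr
  obtain ⟨h1, h2, -, -⟩ := h.eq_zero (x := p) (y := r) (z := 0) (w := 0) (by rw [← hpr]; module)
  exact ⟨h1, h2⟩

lemma IsFrame.isLn_ruling {a b c d : Fin 4 → F} (h : IsFrame a b c d) (s : F) :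
    IsLn F (span F {s • a + c, s • b + d}) := by
  refine isLn_span_pair ?_ ?_
  · rw [LinearIndependent.pair_iff]
    intro p r hpr
    obtain ⟨-, -, h3, h4⟩ := h.eq_zero (x := p * s) (y := r * s) (z := p) (w := r)
      (by rw [← hpr]; module)
    exact ⟨h3, h4⟩
  · have := h.B_comb s 0 1 0 0 s 0 1
    simpa using this

/-- If the line `<a, c>` is not `ℓ0`, where `a ∈ ℓ0`, then the lines of the ruling of the grid
that do not contain `a` are disjoint from `ℓ0`. -/
lemma IsFrame.ruling_mem_L1 {a b c d : Fin 4 → F} (h : IsFrame a b c d) (h2 : (2 : F) = 0)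
    (hl0 : IsLn F (l0 F)) (ha : a ∈ l0 F) (hac : span F {a, c} ≠ l0 F) (s : F) :
    span F {s • a + c, s • b + d} ∈ L1 F := by
  refine ⟨h.isLn_ruling s, ?_⟩
  rw [eq_bot_iff]
  rintro v ⟨hv, hv0⟩
  obtain ⟨p, r, rfl⟩ := mem_span_pair.1 hv
  have hr : r = 0 := by
    have h1 := hl0.2 a ha _ hv0
    simpa [B_add_right, B_smul_right, B_self, h.ab, h.ac, h.ad] using h1
  subst hr
  by_cases hp : p = 0
  · simp [hp]
  · exfalso
    apply hac
    have hc : c ∈ l0 F := by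
      have h1 : s • a + c ∈ l0 F := by
        have := (l0 F).smul_mem p⁻¹ hv0
        simpa [smul_smul, hp] using this
      simpa using (l0 F).sub_mem h1 ((l0 F).smul_mem s ha)
    apply Submodule.eq_of_le_of_finrank_eq
    · simp [span_le, Set.insert_subset_iff, ha, hc]
    · rw [(h.swap h2).isLn_ab.1, hl0.1]

lemma sum_ruling_indicator [Fintype F] {x y z w : F} (h : ¬(x = 0 ∧ y = 0 ∧ z = 0 ∧ w = 0)) :
    (if z = 0 ∧ w = 0 then 1 else 0) + ∑ s : F, (if x = s * z ∧ y = s * w then 1 else 0) =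
      if x * w = y * z then (1 : ZMod 2) else 0 := by
  by_cases hzw : z = 0 ∧ w = 0
  · obtain ⟨rfl, rfl⟩ := hzw
    simp only [mul_zero, and_true, if_true]
    rw [Finset.sum_eq_zero fun s _ => if_neg fun hxy => h ⟨hxy.1, hxy.2, rfl, rfl⟩, add_zero]
  rw [if_neg hzw, zero_add]
  split_ifs with hxw
  · have : ∃ s₀, ∀ s, (x = s * z ∧ y = s * w) ↔ s = s₀ := by
      by_cases hz : z = 0
      · subst hz
        have hw : w ≠ 0 := fun hw => hzw ⟨rfl, hw⟩
        refine ⟨y / w, fun s => ?_⟩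
        have hx : x = 0 := by simpa [hw] using hxw
        rw [eq_div_iff hw]
        simp [hx, eq_comm]
      · refine ⟨x / z, fun s => ?_⟩
        rw [eq_div_iff hz]
        constructor
        · exact fun hs => hs.1.symm
        · rintro rfl
          refine ⟨rfl, ?_⟩
          apply mul_right_cancel₀ hz
          linear_combination -hxw
    obtain ⟨s₀, hs₀⟩ := this
    simp [hs₀]
  · refine Finset.sum_eq_zero fun s _ => if_neg ?_
    rintro ⟨rfl, rfl⟩
    exact hxw (by ring)

lemma chi_apply_of_eq_span (l : Submodule F (Fin 4 → F)) {p : Pt F} {v : Fin 4 → F}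
    (hv : (p : Submodule F (Fin 4 → F)) = span F {v}) : chi F l p = if v ∈ l then 1 else 0 := by
  simp only [chi, hv, span_singleton_le_iff_mem]

lemma Pt.exists_eq_span (p : Pt F) :
    ∃ v : Fin 4 → F, v ≠ 0 ∧ (p : Submodule F (Fin 4 → F)) = span F {v} := by
  have hp : finrank F p.1 = 1 := p.2
  obtain ⟨⟨v, hv⟩, hv0, -⟩ := finrank_eq_one_iff'.1 hp
  have hv0' : v ≠ 0 := fun h => hv0 (by simpa using h)
  refine ⟨v, hv0', ?_⟩
  symm
  apply Submodule.eq_of_le_of_finrank_eq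
  · simpa [span_le] using hv
  · rw [hp, finrank_span_singleton hv0']

/-- The lines of one ruling of a grid have the same sum as the lines of the other ruling. -/
lemma IsFrame.chi_add_sum_ruling [Fintype F] {a b c d : Fin 4 → F} (h : IsFrame a b c d)
    (h2 : (2 : F) = 0) :
    chi F (span F {a, b}) + ∑ s : F, chi F (span F {s • a + c, s • b + d}) =
      chi F (span F {a, c}) + ∑ s : F, chi F (span F {s • a + b, s • c + d}) := by
  ext p
  obtain ⟨v, hv0, hv⟩ := p.exists_eq_span
  simp only [Pi.add_apply, Finset.sum_apply, chi_apply_of_eq_span _ hv]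
  obtain ⟨x, y, z, w, rfl⟩ := h.exists_comb v
  have hne : ¬(x = 0 ∧ y = 0 ∧ z = 0 ∧ w = 0) := by
    rintro ⟨rfl, rfl, rfl, rfl⟩
    simp at hv0
  have hne' : ¬(x = 0 ∧ z = 0 ∧ y = 0 ∧ w = 0) := fun h' => hne ⟨h'.1, h'.2.2.1, h'.2.1, h'.2.2.2⟩
  have hswap : x • a + y • b + z • c + w • d = x • a + z • c + y • b + w • d := by abel
  simp only [h.mem_span_ab, h.mem_span_ruling]
  rw [sum_ruling_indicator hne]
  simp only [hswap, (h.swap h2).mem_span_ab, (h.swap h2).mem_span_ruling]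
  rw [sum_ruling_indicator hne', mul_comm y z]

/-- Two distinct lines through a point are spanned by vectors of a symplectic frame. -/
lemma exists_isFrame {l m : Submodule F (Fin 4 → F)} (hl : IsLn F l) (hm : IsLn F m)
    (hlm : l ≠ m) {a : Fin 4 → F} (ha0 : a ≠ 0) (hal : a ∈ l) (ham : a ∈ m) :
    ∃ b c d, IsFrame a b c d ∧ l = span F {a, b} ∧ m = span F {a, c} := by
  obtain ⟨b, rfl⟩ := exists_eq_span_pair hl.1 hal ha0
  obtain ⟨c, rfl⟩ := exists_eq_span_pair hm.1 ham ha0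
  have hbl : b ∈ span F {a, b} := subset_span (by simp)
  have hcm : c ∈ span F {a, c} := subset_span (by simp)
  have hab : B F a b = 0 := hl.2 a hal b hbl
  have hac : B F a c = 0 := hm.2 a ham c hcm
  have hbc : B F b c ≠ 0 := by
    intro hbc
    have hc : c ∈ span F {a, b} := by
      apply hl.mem_of_orthogonal
      intro u hu
      obtain ⟨p, r, rfl⟩ := mem_span_pair.1 hu
      simp [B_add_left, B_smul_left, hac, hbc]
    apply hlm
    symm
    apply Submodule.eq_of_le_of_finrank_eq
    · simp [span_le, Set.insert_subset_iff, hal, hc]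
    · rw [hl.1, hm.1]
  obtain ⟨u, hu⟩ := exists_B_ne_zero ha0
  set c' := (B F b c)⁻¹ • c with hc'
  set u' := (B F a u)⁻¹ • u with hu'
  have hac' : B F a c' = 0 := by simp [hc', B_smul_right, hac]
  have hbc' : B F b c' = 1 := by simp [hc', B_smul_right, hbc]
  have hau' : B F a u' = 1 := by simp [hu', B_smul_right, hu]
  refine ⟨b, c', u' + B F c' u' • b - B F b u' • c', ⟨hab, hac', ?_, hbc', ?_, ?_⟩, rfl, ?_⟩
  · simp [sub_eq_add_neg, ← neg_smul, B_add_right, B_smul_right, hau', hab, hac']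
  · simp [sub_eq_add_neg, ← neg_smul, B_add_right, B_smul_right, B_self, hbc']
  · simp [sub_eq_add_neg, ← neg_smul, B_add_right, B_smul_right, B_self, B_neg_swap c' b, hbc']
  · rw [span_insert, span_insert, hc', span_singleton_smul_eq (by simpa using hbc)]

lemma isFrame_e : IsFrame (e F 0) (e F 1) (e F 2) (e F 3) := by
  constructor <;> simp [B, e]

lemma isLn_l0 : IsLn F (l0 F) := isFrame_e.isLn_ab

/-- Two lines other than `ℓ0` through a point of `ℓ0` are congruent modulo `C(P,L1)`. -/
lemma chi_mem_of_common_point [Fintype F] {S : Submodule (ZMod 2) (Pt F → ZMod 2)}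
    (h2 : (2 : F) = 0) (hS : chi F '' L1 F ⊆ S) {l m : Submodule F (Fin 4 → F)} (hl : IsLn F l) (hm : IsLn F m)
    (hl0 : l ≠ l0 F) (hm0 : m ≠ l0 F) {a : Fin 4 → F} (ha0 : a ≠ 0) (ha : a ∈ l0 F)
    (hal : a ∈ l) (ham : a ∈ m) (hmS : chi F m ∈ S) : chi F l ∈ S := by
  by_cases hlm : l = m
  · rwa [hlm]
  obtain ⟨b, c, d, h, rfl, rfl⟩ := exists_isFrame hl hm hlm ha0 hal ham
  rw [eq_sub_of_add_eq (h.chi_add_sum_ruling h2)]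
  refine S.sub_mem (S.add_mem hmS (S.sum_mem fun s _ => hS ⟨_, ?_, rfl⟩))
    (S.sum_mem fun s _ => hS ⟨_, ?_, rfl⟩)
  · exact (h.swap h2).ruling_mem_L1 h2 isLn_l0 ha hl0 s
  · exact h.ruling_mem_L1 h2 isLn_l0 ha hm0 s

lemma e_two_notMem_l0 : e F 2 ∉ l0 F := by
  have := isFrame_e.mem_span_ab (F := F) 0 0 1 0
  simpa [l0] using this

lemma chi_ne_chi_l0 {l : Submodule F (Fin 4 → F)} (hl : e F 2 ∈ l) : chi F l ≠ chi F (l0 F) := by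
  intro h
  have hp : IsPt F (span F {e F 2}) := finrank_span_singleton (by simp [e])
  have := congrFun h ⟨_, hp⟩
  rw [chi_apply_of_eq_span l rfl, chi_apply_of_eq_span (l0 F) rfl, if_pos hl,
    if_neg e_two_notMem_l0] at this
  exact one_ne_zero this

theorem span_X0_Y_L1_eq_CPL (t : ℕ) (ht : 0 < t) (q : ℕ)
    (hq : q = 2 ^ t) (hcard : Fintype.card k = q)
    -- `Y`: for each point `p ≠ p0` on `ℓ0`, a chosen line `ℓ_p ∈ L \ {ℓ0}` through `p`
    (lsel : Pt k → Submodule k (Fin 4 → k))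
    (hsel : ∀ p : Pt k, (p : Submodule k (Fin 4 → k)) ≤ l0 k →
      (p : Submodule k (Fin 4 → k)) ≠ p0 k →
      IsLn k (lsel p) ∧ lsel p ≠ l0 k ∧ (p : Submodule k (Fin 4 → k)) ≤ lsel p)
    (Y : Set (Pt k → ZMod 2))
    (hY : Y = (fun p => chi k (lsel p)) ''
      {p : Pt k | (p : Submodule k (Fin 4 → k)) ≤ l0 k ∧
        (p : Submodule k (Fin 4 → k)) ≠ p0 k}) :
    span (ZMod 2) (X0 k ∪ Y ∪ chi k '' L1 k) = CPL k ∧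
    ∀ l : Submodule k (Fin 4 → k), IsLn k l →
      chi k l ∈ span (ZMod 2) (X0 k ∪ Y ∪ chi k '' L1 k) := by
  have h2 : (2 : k) = 0 := by
    have h := Nat.cast_card_eq_zero k
    rw [hcard, hq, Nat.cast_pow] at h
    exact_mod_cast pow_eq_zero_iff ht.ne' |>.1 h
  set S := span (ZMod 2) (X0 k ∪ Y ∪ chi k '' L1 k) with hSdef
  have hX : X0 k ⊆ S := fun x hx => subset_span (Or.inl (Or.inl hx))
  have hYS : Y ⊆ S := fun x hx => subset_span (Or.inl (Or.inr hx))
  have hL : chi k '' L1 k ⊆ S := fun x hx => subset_span (Or.inr hx)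
  have hmeet : ∀ l, IsLn k l → l ≠ l0 k → ∀ a ∈ l, a ∈ l0 k → a ≠ 0 → span k {a} ≠ p0 k →
      chi k l ∈ S := by
    intro l hl hl0 a hal ha ha0 hap
    have hp : IsPt k (span k {a}) := finrank_span_singleton ha0
    have hle : span k {a} ≤ l0 k := by simpa [span_le] using ha
    obtain ⟨hm, hm0, ham⟩ := hsel ⟨_, hp⟩ hle hap
    refine chi_mem_of_common_point h2 hL hl hm hl0 hm0 ha0 ha hal
      (ham (mem_span_singleton_self a)) (hYS ?_)
    rw [hY]
    exact ⟨⟨_, hp⟩, ⟨hle, hap⟩, rfl⟩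
  have hl0S : chi k (l0 k) ∈ S := by
    have hf := isFrame_e (F := k)
    have heq := eq_sub_of_add_eq (hf.chi_add_sum_ruling h2)
    rw [← l0] at heq
    rw [heq]
    have he0 : e k 0 ∈ l0 k := subset_span (by simp)
    have he1 : e k 1 ∈ l0 k := subset_span (by simp)
    refine S.sub_mem (S.add_mem (hX ⟨⟨_, ⟨(hf.swap h2).isLn_ab, ?_⟩, rfl⟩, ?_⟩)
      (S.sum_mem fun s _ => ?_)) (S.sum_mem fun s _ => hL ⟨_, ?_, rfl⟩)
    · exact span_mono (by simp)
    · exact chi_ne_chi_l0 (subset_span (by simp))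
    · refine hmeet _ ((hf.swap h2).isLn_ruling s) ?_ (s • e k 0 + e k 1) (subset_span (by simp))
        ((l0 k).add_mem ((l0 k).smul_mem s he0) he1) ?_ ?_
      · intro h
        have h3 : s • e k 2 + e k 3 ∈ l0 k := h ▸ subset_span (by simp)
        have := (hf.mem_span_ab 0 0 s 1).1 (by simpa [l0] using h3)
        exact one_ne_zero this.2
      · intro h
        have := (hf.eq_zero (x := s) (y := 1) (z := 0) (w := 0) (by simpa using h)).2.1
        exact one_ne_zero this
      · intro h
        have h1 : s • e k 0 + e k 1 ∈ p0 k := h ▸ mem_span_singleton_self _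
        obtain ⟨r, hr⟩ := mem_span_singleton.1 h1
        have := congrFun hr 1
        simp [e] at this
    · refine hf.ruling_mem_L1 h2 isLn_l0 he0 ?_ s
      intro h
      exact e_two_notMem_l0 (h ▸ subset_span (by simp))
  have hall : ∀ l, IsLn k l → chi k l ∈ S := by
    intro l hl
    by_cases hchi : chi k l = chi k (l0 k)
    · rwa [hchi]
    by_cases hpl : p0 k ≤ l
    · exact hX ⟨⟨l, ⟨hl, hpl⟩, rfl⟩, hchi⟩
    by_cases hbot : l ⊓ l0 k = ⊥
    · exact hL ⟨l, ⟨hl, hbot⟩, rfl⟩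
    obtain ⟨a, ⟨hal, ha⟩, ha0⟩ := (Submodule.ne_bot_iff _).1 hbot
    refine hmeet l hl (fun h => hchi (h ▸ rfl)) a hal ha ha0 fun h => hpl ?_
    rw [← h]
    simpa [span_le] using hal
  refine ⟨le_antisymm ?_ ?_, hall⟩
  · rw [hSdef, span_le, Set.union_subset_iff, Set.union_subset_iff]
    refine ⟨⟨?_, ?_⟩, ?_⟩
    · rintro _ ⟨⟨l, hl, rfl⟩, -⟩
      exact subset_span ⟨l, hl.1, rfl⟩
    · rw [hY]
      rintro _ ⟨p, ⟨hp, hp0⟩, rfl⟩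
      exact subset_span ⟨_, (hsel p hp hp0).1, rfl⟩
    · rintro _ ⟨l, hl, rfl⟩
      exact subset_span ⟨l, hl.1, rfl⟩
  · rw [CPL, span_le]
    rintro _ ⟨l, hl, rfl⟩
    exact hall l hl
end
end

section
/- Let q = 2^t for a positive integer t. Suppose h ∈ k[x0,x1,x2] is a polynomial in which every indeterminate has degree at most q-1, and suppose the class (1 + x3^{q-1})·h + I lies in the k-span of the classes of the line polynomials (1 + α^{q-1})(1 + β^{q-1}) + I over all lines ℓ ∈ L (α, β linear forms whose common zero set is ℓ). Then every non-constant monomial m of h has the form m = ∏_{i=0}^{t-1} g_i^{2^i}, where each g_i is one of the single variables x0, x1, x2 (i.e., every digit of m has degree 1). -/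
open Submodule Module MvPolynomial
open scoped Classical

noncomputable section

variable (k : Type) [Field k] [Fintype k]

/-- The ideal `I = (x0^q - x0, x1^q - x1, x2^q - x2, x3^q - x3)` of `R = k[x0,x1,x2,x3]`. -/
def II (q : ℕ) : Ideal (MvPolynomial (Fin 4) k) :=
  Ideal.span (Set.range fun i : Fin 4 => X i ^ q - X i)

/-- The linear form `a0*x0 + a1*x1 + a2*x2 + a3*x3`. -/
def linForm (a : Fin 4 → k) : MvPolynomial (Fin 4) k := ∑ i : Fin 4, C (a i) * X i

/-- The polynomials `(1 + α^{q-1})(1 + β^{q-1})` for pairs of linear forms `α, β`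
whose common zero set in `V` is exactly a line `ℓ ∈ L`. -/
def linePolys (q : ℕ) : Set (MvPolynomial (Fin 4) k) :=
  {c | ∃ (l : Submodule k (Fin 4 → k)) (a b : Fin 4 → k), IsLn k l ∧
    {v : Fin 4 → k | eval v (linForm k a) = 0 ∧ eval v (linForm k b) = 0}
      = (l : Set (Fin 4 → k)) ∧
    c = (1 + linForm k a ^ (q - 1)) * (1 + linForm k b ^ (q - 1))}

/-- The allowed digits. -/
def digitSet : Set (MvPolynomial (Fin 4) k) :=
  {1, X 0, X 1, X 2, X 3, X 0 * X 1, X 0 * X 2, X 1 * X 3, X 2 * X 3, X 0 * X 3 + X 1 * X 2}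

/-- The set `β` of products `∏ f_i^{2^i}` with every digit `f_i` in `digitSet`. -/
def betaSet (t : ℕ) : Set (MvPolynomial (Fin 4) k) :=
  {g | ∃ f : Fin t → MvPolynomial (Fin 4) k,
    (∀ i, f i ∈ digitSet k) ∧ g = ∏ i : Fin t, f i ^ 2 ^ (i : ℕ)}

/-- Doubling of exponents of reduced monomials: `x ^ (2 * e) = x ^ doubleExp q e` on a field of
order `q`, cyclically shifting the binary digits of `e`. -/
def doubleExp (q e : ℕ) : ℕ := if 2 * e < q then 2 * e else 2 * e - (q - 1)

/-- The leading binary digit of an exponent `e < q`. -/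
def topDigit (q e : ℕ) : ℕ := if 2 * e < q then 0 else 1

lemma topDigit_le_one (q e : ℕ) : topDigit q e ≤ 1 := by
  unfold topDigit; split_ifs <;> omega

lemma topDigit_zero {q : ℕ} (hq : 0 < q) : topDigit q 0 = 0 := by
  simp [topDigit, hq]

lemma doubleExp_zero {q : ℕ} (hq : 0 < q) : doubleExp q 0 = 0 := by
  simp [doubleExp, hq]

lemma doubleExp_pos {q e : ℕ} (he : 0 < e) : 0 < doubleExp q e := by
  unfold doubleExp; split_ifs <;> omega

lemma doubleExp_le {q e : ℕ} (he : e ≤ q - 1) : doubleExp q e ≤ q - 1 := by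
  unfold doubleExp; split_ifs <;> omega

lemma doubleExp_pred {q : ℕ} (hq : 1 < q) : doubleExp q (q - 1) = q - 1 := by
  unfold doubleExp; split_ifs <;> omega

lemma two_mul_eq_doubleExp_add (q e : ℕ) :
    2 * e = doubleExp q e + (q - 1) * topDigit q e := by
  unfold doubleExp topDigit; split_ifs <;> omega

lemma doubleExp_injOn {q : ℕ} (hq : Even q) {a b : ℕ} (ha : a ≤ q - 1) (hb : b ≤ q - 1)
    (h : doubleExp q a = doubleExp q b) : a = b := by
  obtain ⟨r, rfl⟩ := hq
  unfold doubleExp at h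
  split_ifs at h <;> omega

lemma two_pow_mul_eq_iterate_doubleExp_add (q e n : ℕ) :
    2 ^ n * e = (doubleExp q)^[n] e +
      (q - 1) * ∑ j ∈ Finset.range n, 2 ^ (n - 1 - j) * topDigit q ((doubleExp q)^[j] e) := by
  induction n with
  | zero => simp
  | succ n ih =>
    have hs : ∑ j ∈ Finset.range n, 2 ^ (n + 1 - 1 - j) * topDigit q ((doubleExp q)^[j] e) =
        2 * ∑ j ∈ Finset.range n, 2 ^ (n - 1 - j) * topDigit q ((doubleExp q)^[j] e) := by
      rw [Finset.mul_sum]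
      refine Finset.sum_congr rfl fun j hj => ?_
      have hj' := Finset.mem_range.1 hj
      rw [show n + 1 - 1 - j = (n - 1 - j) + 1 by omega, pow_succ]
      ring
    rw [Finset.sum_range_succ, hs, Function.iterate_succ_apply']
    have h2 := two_mul_eq_doubleExp_add q ((doubleExp q)^[n] e)
    rw [pow_succ, mul_comm (2 ^ n) 2, mul_assoc, ih, mul_add, h2]
    simp only [Nat.add_sub_cancel, Nat.sub_self, pow_zero, one_mul]
    ring

lemma iterate_doubleExp_le {q e : ℕ} (he : e ≤ q - 1) (n : ℕ) :
    (doubleExp q)^[n] e ≤ q - 1 := by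
  induction n with
  | zero => exact he
  | succ n ih => rw [Function.iterate_succ_apply']; exact doubleExp_le ih

lemma iterate_doubleExp_pos {q e : ℕ} (he : 0 < e) (n : ℕ) : 0 < (doubleExp q)^[n] e := by
  induction n with
  | zero => exact he
  | succ n ih => rw [Function.iterate_succ_apply']; exact doubleExp_pos ih

/-- The binary expansion of an exponent, read off from its cyclic shifts. -/
lemma eq_sum_topDigit {t e : ℕ} (ht : 0 < t) (he : e ≤ 2 ^ t - 1) :
    e = ∑ j ∈ Finset.range t, 2 ^ (t - 1 - j) * topDigit (2 ^ t) ((doubleExp (2 ^ t))^[j] e) := by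
  have hq : 1 < 2 ^ t := Nat.one_lt_two_pow ht.ne'
  rcases Nat.eq_zero_or_pos e with rfl | hpos
  · have hfix (j : ℕ) : (doubleExp (2 ^ t))^[j] 0 = 0 :=
      Function.iterate_fixed (doubleExp_zero (by omega)) j
    simp [hfix, topDigit_zero]
  · have key := two_pow_mul_eq_iterate_doubleExp_add (2 ^ t) e t
    have hle := iterate_doubleExp_le he t
    have hp := iterate_doubleExp_pos (q := 2 ^ t) hpos t
    generalize ∑ j ∈ Finset.range t,
      2 ^ (t - 1 - j) * topDigit (2 ^ t) ((doubleExp (2 ^ t))^[j] e) = s at *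
    generalize (doubleExp (2 ^ t))^[t] e = r at *
    generalize 2 ^ t = q at *
    obtain ⟨p, rfl⟩ : ∃ p, q = p + 1 := ⟨q - 1, by omega⟩
    simp only [Nat.add_sub_cancel] at *
    rcases lt_trichotomy e s with hlt | heq | hgt
    · nlinarith
    · exact heq
    · nlinarith

/-- A family of exponents all of whose cyclic shifts have total degree `q - 1` is a sum of
single variables, one for each binary place. -/
lemma exists_eq_sum_single_of_degree_iterate {σ : Type*} [Fintype σ] {t : ℕ} (ht : 0 < t)
    (m : σ →₀ ℕ) (hm : ∀ i, m i ≤ 2 ^ t - 1)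
    (hdeg : ∀ j, ∑ i, (doubleExp (2 ^ t))^[j] (m i) = 2 ^ t - 1) :
    ∃ g : Fin t → σ, (∀ i, m (g i) ≠ 0) ∧
      m = ∑ i : Fin t, Finsupp.single (g i) (2 ^ (i : ℕ)) := by
  have hq : 1 < 2 ^ t := Nat.one_lt_two_pow ht.ne'
  have hsum (j : ℕ) : ∑ i, topDigit (2 ^ t) ((doubleExp (2 ^ t))^[j] (m i)) = 1 := by
    have h1 : ∑ i, 2 * (doubleExp (2 ^ t))^[j] (m i) =
        ∑ i, ((doubleExp (2 ^ t))^[j + 1] (m i) +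
          (2 ^ t - 1) * topDigit (2 ^ t) ((doubleExp (2 ^ t))^[j] (m i))) :=
      Finset.sum_congr rfl fun i _ => by
        rw [Function.iterate_succ_apply', ← two_mul_eq_doubleExp_add]
    rw [Finset.sum_add_distrib, ← Finset.mul_sum, ← Finset.mul_sum, hdeg, hdeg] at h1
    have h2 : 0 < 2 ^ t - 1 := by omega
    refine Nat.eq_of_mul_eq_mul_left h2 ?_
    omega
  have hex (j : ℕ) : ∃ v, ∀ i,
      topDigit (2 ^ t) ((doubleExp (2 ^ t))^[j] (m i)) = if v = i then 1 else 0 := by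
    obtain ⟨v, -, hv⟩ := Finset.exists_ne_zero_of_sum_ne_zero
      (by rw [hsum j]; exact one_ne_zero :
        ∑ i, topDigit (2 ^ t) ((doubleExp (2 ^ t))^[j] (m i)) ≠ 0)
    have hv1 : topDigit (2 ^ t) ((doubleExp (2 ^ t))^[j] (m v)) = 1 :=
      le_antisymm (topDigit_le_one _ _) (Nat.one_le_iff_ne_zero.2 hv)
    refine ⟨v, fun i => ?_⟩
    split_ifs with hi
    · rw [← hi, hv1]
    · have h3 := hsum j
      rw [← Finset.add_sum_erase _ _ (Finset.mem_univ v), hv1] at h3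
      have h4 := Finset.single_le_sum (f := fun i => topDigit (2 ^ t)
        ((doubleExp (2 ^ t))^[j] (m i))) (fun _ _ => Nat.zero_le _)
        (Finset.mem_erase.2 ⟨Ne.symm hi, Finset.mem_univ i⟩)
      omega
  choose v hv using hex
  refine ⟨fun i => v (t - 1 - i), fun i h0 => ?_, ?_⟩
  · have h1 := hv (t - 1 - i) (v (t - 1 - i))
    rw [h0, Function.iterate_fixed (doubleExp_zero (by omega)), topDigit_zero (by omega)] at h1
    simp at h1
  · ext i
    rw [eq_sum_topDigit ht (hm i), Finsupp.finsetSum_apply, ← Finset.sum_range_reflect,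
      Finset.sum_range]
    refine Finset.sum_congr rfl fun j _ => ?_
    rw [hv, Finsupp.single_apply, show t - 1 - (t - 1 - (j : ℕ)) = j by omega]
    simp

/-- Reduction of exponents with respect to `x ^ q = x`. -/
def reduceExp (q e : ℕ) : ℕ := if e = 0 then 0 else (e - 1) % (q - 1) + 1

lemma reduceExp_zero (q : ℕ) : reduceExp q 0 = 0 := if_pos rfl

lemma reduceExp_le_pred {q : ℕ} (hq : 1 < q) (e : ℕ) : reduceExp q e ≤ q - 1 := by
  unfold reduceExp
  split_ifs
  · omega
  · have := Nat.mod_lt (e - 1) (show q - 1 > 0 by omega)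
    omega

lemma exists_eq_reduceExp_add (q e : ℕ) : ∃ c, e = reduceExp q e + (q - 1) * c := by
  unfold reduceExp
  split_ifs with h
  · exact ⟨0, by simp [h]⟩
  · refine ⟨(e - 1) / (q - 1), ?_⟩
    have := Nat.mod_add_div (e - 1) (q - 1)
    omega

/-- Exponents of degree at most `2 * (q - 1)` and divisible by `q - 1`. -/
def lineExps (q : ℕ) : Set (Fin 4 →₀ ℕ) := {e | e.degree ≤ 2 * (q - 1) ∧ q - 1 ∣ e.degree}

/-- The members of `lineExps` with all entries at most `q - 1`. -/
def reducedLineExps (q : ℕ) : Set (Fin 4 →₀ ℕ) := {e ∈ lineExps q | ∀ i, e i ≤ q - 1}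

section

variable {k}

lemma pow_doubleExp {q : ℕ} (hq : 1 < q) (hcard : Fintype.card k = q) (x : k) (e : ℕ) :
    x ^ doubleExp q e = (x ^ e) ^ 2 := by
  rw [← pow_mul, mul_comm e 2]
  unfold doubleExp
  split_ifs with h
  · rfl
  · rw [show 2 * e - (q - 1) = (2 * e - q) + 1 by omega,
      show x ^ (2 * e) = x ^ ((2 * e - q) + q) by congr 1; omega, pow_add, pow_add, pow_one,
      ← hcard, FiniteField.pow_card]

lemma pow_reduceExp {q : ℕ} (hcard : Fintype.card k = q) (x : k) (e : ℕ) :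
    x ^ reduceExp q e = x ^ e := by
  unfold reduceExp
  split_ifs with h
  · rw [h]
  · by_cases hx : x = 0
    · rw [hx, zero_pow h, zero_pow (Nat.succ_ne_zero _)]
    · have h1 : x ^ (q - 1) = 1 := by rw [← hcard]; exact FiniteField.pow_card_sub_one_eq_one x hx
      conv_rhs => rw [show e = (e - 1) + 1 by omega, ← Nat.mod_add_div (e - 1) (q - 1)]
      rw [pow_add, pow_add, pow_add, pow_mul, h1, one_pow, mul_one]

lemma evalₗ_mem_of_mem_lineExps {q : ℕ} (hq : 1 < q) (hcard : Fintype.card k = q)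
    {p : MvPolynomial (Fin 4) k} (hp : p ∈ restrictSupport k (lineExps q)) :
    evalₗ k (Fin 4) p ∈ (restrictSupport k (reducedLineExps q)).map (evalₗ k (Fin 4)) := by
  rw [p.as_sum, map_sum]
  refine Submodule.sum_mem _ fun e he => ?_
  have he' : e ∈ lineExps q := (mem_restrictSupport_iff k).1 hp he
  refine ⟨monomial (e.mapRange (reduceExp q) (reduceExp_zero q)) (coeff e p), ?_, ?_⟩
  · refine (mem_restrictSupport_iff k).2 fun d hd => ?_
    have hd' := Finset.mem_singleton.1 (support_monomial_subset hd)
    subst hd'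
    choose c hc using exists_eq_reduceExp_add q
    have h1 : e.degree = (e.mapRange (reduceExp q) (reduceExp_zero q)).degree +
        (q - 1) * ∑ i, c (e i) := by
      rw [Finsupp.degree_eq_sum, Finsupp.degree_eq_sum, Finset.mul_sum, ← Finset.sum_add_distrib]
      exact Finset.sum_congr rfl fun i _ => hc (e i)
    refine ⟨⟨by have := he'.1; omega, ?_⟩, fun i => reduceExp_le_pred hq _⟩
    exact (Nat.dvd_add_left (Dvd.intro _ rfl)).1 (h1 ▸ he'.2)
  · ext v
    simp [evalₗ_apply, eval_monomial, Finsupp.prod_fintype, pow_reduceExp hcard]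

lemma linForm_isHomogeneous {K : Type} [Field K] (a : Fin 4 → K) : (linForm K a).IsHomogeneous 1 :=
  IsHomogeneous.sum _ _ _ fun i _ => by
    simpa using (isHomogeneous_C (Fin 4) (a i)).mul (isHomogeneous_X K i)

lemma mem_restrictSupport_lineExps_of_isHomogeneous {K : Type*} [Field K] {q n : ℕ}
    {p : MvPolynomial (Fin 4) K}
    (hp : p.IsHomogeneous (n * (q - 1))) (hn : n ≤ 2) : p ∈ restrictSupport K (lineExps q) := by
  refine (mem_restrictSupport_iff K).2 fun e he => ?_
  have h1 : e.degree = n * (q - 1) := by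
    by_contra h
    exact MvPolynomial.mem_support_iff.1 he (hp.coeff_eq_zero h)
  exact ⟨h1 ▸ Nat.mul_le_mul_right _ hn, h1 ▸ Dvd.intro_left _ rfl⟩

lemma linePolys_subset {K : Type} [Field K] (q : ℕ) :
    linePolys K q ⊆ restrictSupport K (lineExps q) := by
  rintro _ ⟨l, a, b, -, -, rfl⟩
  have ha : (linForm K a ^ (q - 1)).IsHomogeneous (1 * (q - 1)) :=
    (linForm_isHomogeneous a).pow _
  have hb : (linForm K b ^ (q - 1)).IsHomogeneous (1 * (q - 1)) :=
    (linForm_isHomogeneous b).pow _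
  have h1 : (1 : MvPolynomial (Fin 4) K).IsHomogeneous (0 * (q - 1)) := by
    simpa using isHomogeneous_one (Fin 4) K
  have hab := ha.mul hb
  rw [← add_mul] at hab
  rw [mul_add, mul_one, add_mul, one_mul]
  exact add_mem (add_mem (mem_restrictSupport_lineExps_of_isHomogeneous h1 (by norm_num))
    (mem_restrictSupport_lineExps_of_isHomogeneous ha (by norm_num)))
    (add_mem (mem_restrictSupport_lineExps_of_isHomogeneous hb (by norm_num))
      (mem_restrictSupport_lineExps_of_isHomogeneous hab (by norm_num)))

lemma evalₗ_linePoly_sq [CharP k 2] {q : ℕ} (hq : 1 < q) (hcard : Fintype.card k = q)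
    {p : MvPolynomial (Fin 4) k} (hp : p ∈ linePolys k q) :
    evalₗ k (Fin 4) p ^ 2 = evalₗ k (Fin 4) p := by
  obtain ⟨l, a, b, -, -, rfl⟩ := hp
  have hx (x : k) : (1 + x ^ (q - 1)) ^ 2 = 1 + x ^ (q - 1) := by
    by_cases hx : x = 0
    · rw [hx, zero_pow (by omega)]; simp
    · rw [← hcard, FiniteField.pow_card_sub_one_eq_one x hx, CharTwo.add_self_eq_zero]; simp
  ext v
  simp [evalₗ_apply, mul_pow, hx]

lemma sq_mem_span_evalₗ_linePolys [CharP k 2] {q : ℕ} (hq : 1 < q) (hcard : Fintype.card k = q)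
    {f : (Fin 4 → k) → k} (hf : f ∈ span k (evalₗ k (Fin 4) '' linePolys k q)) :
    f ^ 2 ∈ span k (evalₗ k (Fin 4) '' linePolys k q) := by
  induction hf using Submodule.span_induction with
  | mem f hf =>
    obtain ⟨p, hp, rfl⟩ := hf
    rw [evalₗ_linePoly_sq hq hcard hp]
    exact subset_span ⟨p, hp, rfl⟩
  | zero => simp
  | add f g _ _ hf hg =>
    have : (f + g) ^ 2 = f ^ 2 + g ^ 2 := by
      ext v; simp [CharTwo.add_sq]
    exact this ▸ add_mem hf hg
  | smul c f _ hf =>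
    rw [smul_pow]
    exact Submodule.smul_mem _ _ hf

lemma mem_lineExps_of_evalₗ_mem_span {q : ℕ} (hq : 1 < q) (hcard : Fintype.card k = q)
    {p : MvPolynomial (Fin 4) k} (hp : p ∈ restrictDegree (Fin 4) k (q - 1))
    (hspan : evalₗ k (Fin 4) p ∈ span k (evalₗ k (Fin 4) '' linePolys k q))
    {e : Fin 4 →₀ ℕ} (he : e ∈ p.support) : e ∈ lineExps q := by
  have hle : span k (evalₗ k (Fin 4) '' linePolys k q) ≤
      (restrictSupport k (reducedLineExps q)).map (evalₗ k (Fin 4)) := by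
    rw [span_le]
    rintro _ ⟨r, hr, rfl⟩
    exact evalₗ_mem_of_mem_lineExps hq hcard (linePolys_subset q hr)
  obtain ⟨r, hr, hrp⟩ := hle hspan
  have hr' := (mem_restrictSupport_iff k).1 hr
  have hrd : r ∈ restrictDegree (Fin 4) k (q - 1) :=
    (mem_restrictDegree _ _ _).2 fun s hs i => (hr' hs).2 i
  have h0 : p - r = 0 := by
    refine eq_zero_of_eval_eq_zero _ _ _ (fun v => ?_) (hcard ▸ sub_mem hp hrd)
    have := congrFun hrp v
    simp only [evalₗ_apply] at this
    rw [map_sub, this, sub_self]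
  rw [sub_eq_zero.1 h0] at he
  exact (hr' he).1

lemma exists_sq_restrictDegree [CharP k 2] {q : ℕ} (hq : 1 < q) (hcard : Fintype.card k = q)
    (heven : Even q) {p : MvPolynomial (Fin 4) k} (hp : p ∈ restrictDegree (Fin 4) k (q - 1))
    {e : Fin 4 →₀ ℕ} (he : e ∈ p.support) :
    ∃ r ∈ restrictDegree (Fin 4) k (q - 1), evalₗ k (Fin 4) r = evalₗ k (Fin 4) p ^ 2 ∧
      e.mapRange (doubleExp q) (doubleExp_zero (by omega)) ∈ r.support := by
  have hp' := (mem_restrictDegree _ _ _).1 hp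
  have hz : doubleExp q 0 = 0 := doubleExp_zero (by omega)
  refine ⟨∑ d ∈ p.support, monomial (d.mapRange (doubleExp q) hz) (coeff d p ^ 2),
    Submodule.sum_mem _ fun d hd => ?_, ?_, ?_⟩
  · refine (mem_restrictDegree _ _ _).2 fun s hs i => ?_
    rw [Finset.mem_singleton.1 (support_monomial_subset hs)]
    exact doubleExp_le (hp' d hd i)
  · ext v
    conv_rhs => rw [p.as_sum]
    simp only [map_sum, evalₗ_apply, Pi.pow_apply, Finset.sum_apply]
    rw [CharTwo.sum_sq]
    refine Finset.sum_congr rfl fun d _ => ?_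
    simp [eval_monomial, Finsupp.prod_fintype, pow_doubleExp hq hcard, mul_pow, Finset.prod_pow]
  · rw [MvPolynomial.mem_support_iff, coeff_sum, Finset.sum_eq_single e]
    · rw [coeff_monomial, if_pos rfl]
      exact pow_ne_zero _ (MvPolynomial.mem_support_iff.1 he)
    · intro d hd hde
      rw [coeff_monomial, if_neg]
      intro h
      refine hde (Finsupp.ext fun i => doubleExp_injOn heven (hp' d hd i) (hp' e he i) ?_)
      simpa using DFunLike.congr_fun h i
    · exact fun h => absurd he h

lemma iterate_mem_lineExps [CharP k 2] {q : ℕ} (hq : 1 < q) (hcard : Fintype.card k = q)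
    (heven : Even q) (n : ℕ) {p : MvPolynomial (Fin 4) k}
    (hp : p ∈ restrictDegree (Fin 4) k (q - 1))
    (hspan : evalₗ k (Fin 4) p ∈ span k (evalₗ k (Fin 4) '' linePolys k q))
    {e : Fin 4 →₀ ℕ} (he : e ∈ p.support) :
    ∑ i, (doubleExp q)^[n] (e i) ≤ 2 * (q - 1) ∧ q - 1 ∣ ∑ i, (doubleExp q)^[n] (e i) := by
  induction n generalizing p e with
  | zero =>
    simpa [lineExps, Finsupp.degree_eq_sum] using
      mem_lineExps_of_evalₗ_mem_span hq hcard hp hspan he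
  | succ n ih =>
    obtain ⟨r, hr, hrp, her⟩ := exists_sq_restrictDegree hq hcard heven hp he
    simpa using ih hr (hrp ▸ sq_mem_span_evalₗ_linePolys hq hcard hspan) her

lemma evalₗ_mem_span_of_mk_mem {q : ℕ} (hcard : Fintype.card k = q)
    {p : MvPolynomial (Fin 4) k} {s : Set (MvPolynomial (Fin 4) k)}
    (hp : Ideal.Quotient.mk (II k q) p ∈ span k (Ideal.Quotient.mk (II k q) '' s)) :
    evalₗ k (Fin 4) p ∈ span k (evalₗ k (Fin 4) '' s) := by
  have h1 : p ∈ (span k s) ⊔ (II k q).restrictScalars k := by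
    have h2 : Ideal.Quotient.mk (II k q) p ∈
        (span k s).map (Ideal.Quotient.mkₐ k (II k q)).toLinearMap := by
      rw [Submodule.map_span]; exact hp
    obtain ⟨y, hy, hyp⟩ := h2
    have h3 : p - y ∈ II k q := Ideal.Quotient.eq.1 hyp.symm
    rw [← add_sub_cancel y p]
    exact add_mem (Submodule.mem_sup_left hy) (Submodule.mem_sup_right h3)
  obtain ⟨y, hy, z, hz, rfl⟩ := Submodule.mem_sup.1 h1
  have hz0 : evalₗ k (Fin 4) z = 0 := by
    ext v
    have hle : II k q ≤ RingHom.ker (eval v) := by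
      rw [II, Ideal.span_le]
      rintro _ ⟨i, rfl⟩
      simp [RingHom.mem_ker, ← hcard, FiniteField.pow_card]
    exact hle hz
  rw [map_add, hz0, add_zero, ← Submodule.map_span]
  exact Submodule.mem_map_of_mem hy

end

theorem digits_of_monomials_are_linear (t : ℕ) (ht : 0 < t) (q : ℕ) (hq : q = 2 ^ t)
    (hcard : Fintype.card k = q)
    (h : MvPolynomial (Fin 4) k)
    (hvars : (3 : Fin 4) ∉ h.vars)
    (hdeg : ∀ i : Fin 4, h.degreeOf i ≤ q - 1)
    (hmem : Ideal.Quotient.mk (II k q) ((1 + X 3 ^ (q - 1)) * h) ∈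
      span k (Ideal.Quotient.mk (II k q) '' linePolys k q))
    (m : Fin 4 →₀ ℕ) (hm : m ∈ h.support) (hm0 : m ≠ 0) :
    ∃ g : Fin t → Fin 4, (∀ i, g i ∈ ({0, 1, 2} : Set (Fin 4))) ∧
      m = ∑ i : Fin t, Finsupp.single (g i) (2 ^ (i : ℕ)) := by
  subst hq
  have hq1 : 1 < 2 ^ t := Nat.one_lt_two_pow ht.ne'
  have heven : Even (2 ^ t) := even_two.pow_of_ne_zero ht.ne'
  have hchar : CharP k 2 := by
    obtain ⟨p, hp⟩ := CharP.exists k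
    obtain ⟨n, hpp, hn⟩ := FiniteField.card k p
    have : p ∣ 2 ^ t := hcard ▸ hn ▸ dvd_pow_self p n.pos.ne'
    rwa [← (Nat.prime_dvd_prime_iff_eq hpp Nat.prime_two).1 (hpp.dvd_of_dvd_pow this)]
  have hle (e : Fin 4 →₀ ℕ) (he : e ∈ h.support) (i : Fin 4) : e i ≤ 2 ^ t - 1 :=
    (monomial_le_degreeOf i he).trans (hdeg i)
  have h3 (e : Fin 4 →₀ ℕ) (he : e ∈ h.support) : e 3 = 0 := by
    by_contra h0
    exact hvars ((mem_vars_iff_mem_support 3).2 ⟨e, he, by simpa using h0⟩)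
  have hH : (1 + X 3 ^ (2 ^ t - 1)) * h =
      h + monomial (Finsupp.single 3 (2 ^ t - 1)) 1 * h := by
    rw [add_mul, one_mul, X_pow_eq_monomial]
  have hrest : (1 + X 3 ^ (2 ^ t - 1)) * h ∈ restrictDegree (Fin 4) k (2 ^ t - 1) := by
    rw [hH]
    refine add_mem ((mem_restrictDegree _ _ _).2 hle) ((mem_restrictDegree _ _ _).2 ?_)
    intro s hs i
    rw [MvPolynomial.mem_support_iff, coeff_monomial_mul'] at hs
    split_ifs at hs with hsle
    · rw [one_mul, ← MvPolynomial.mem_support_iff] at hs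
      have h4 := hle _ hs i
      have h5 := h3 _ hs
      rw [Finsupp.tsub_apply] at h4 h5
      by_cases hi : i = 3
      · subst hi; simp at h5; omega
      · simpa [Finsupp.single_apply, Ne.symm hi] using h4
    · exact absurd rfl hs
  have hE : m + Finsupp.single 3 (2 ^ t - 1) ∈ ((1 + X 3 ^ (2 ^ t - 1)) * h).support := by
    rw [hH, MvPolynomial.mem_support_iff, coeff_add, add_comm m, coeff_monomial_mul, one_mul,
      MvPolynomial.notMem_support_iff.1 fun hmem' => ?_, zero_add]
    · exact MvPolynomial.mem_support_iff.1 hm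
    · have := h3 _ hmem'
      simp at this
      omega
  have hsum (j : ℕ) : ∑ i, (doubleExp (2 ^ t))^[j] (m i) = 2 ^ t - 1 := by
    have key := iterate_mem_lineExps hq1 hcard heven j hrest
      (evalₗ_mem_span_of_mk_mem hcard hmem) hE
    have hadd : ∑ i, (doubleExp (2 ^ t))^[j] ((m + Finsupp.single 3 (2 ^ t - 1) : Fin 4 →₀ ℕ) i) =
        ∑ i, (doubleExp (2 ^ t))^[j] (m i) + (2 ^ t - 1) := by
      have h0 : (doubleExp (2 ^ t))^[j] 0 = 0 :=
        Function.iterate_fixed (doubleExp_zero (by omega)) j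
      have h1 : (doubleExp (2 ^ t))^[j] (2 ^ t - 1) = 2 ^ t - 1 :=
        Function.iterate_fixed (doubleExp_pred hq1) j
      simp [Fin.sum_univ_four, h3 m hm, h0, h1, Finsupp.single_apply]
    rw [hadd, Nat.dvd_add_self_right] at key
    obtain ⟨i, hi⟩ := DFunLike.ne_iff.1 hm0
    have hpos : 0 < ∑ i, (doubleExp (2 ^ t))^[j] (m i) :=
      Finset.sum_pos' (fun _ _ => Nat.zero_le _)
        ⟨i, Finset.mem_univ i, iterate_doubleExp_pos (Nat.pos_of_ne_zero hi) j⟩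
    have := Nat.le_of_dvd hpos key.2
    omega
  obtain ⟨g, hg, hmg⟩ := exists_eq_sum_single_of_degree_iterate ht m (hle m hm) hsum
  refine ⟨g, fun i => ?_, hmg⟩
  have hgi : g i ≠ 3 := fun h => hg i (h ▸ h3 m hm)
  revert hgi
  generalize g i = a
  fin_cases a <;> simp
end
end

section
/- Let q = 2^t for a positive integer t. The F_2-subspace {c ∈ C(P,L) : c(p) = 0 for every point p ∈ P1} (that is, ker π ∩ C(P,L)) has dimension exactly q + 1. -/
open Submodule Module
open scoped Classical

noncomputable section

variable (k : Type) [Field k] [Fintype k]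

variable {k}

theorem sum_eq_zero_of_involution {ι : Type*} [Fintype ι] (F : ι → ZMod 2) (σ : ι → ι)
    (hσ : ∀ i, σ (σ i) = i) (hne : ∀ i, σ i ≠ i) (hF : ∀ i, F (σ i) = F i) :
    ∑ i, F i = 0 :=
  Finset.sum_involution (fun i _ => σ i) (fun i _ => by rw [hF, CharTwo.add_self_eq_zero])
    (fun i _ _ => hne i) (fun _ _ => Finset.mem_univ _) (fun i _ => hσ i)

theorem natCast_card_eq_zero [CharP k 2] : ((Fintype.card k : ℕ) : ZMod 2) = 0 := by
  obtain ⟨n, hp, hn⟩ := FiniteField.card k 2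
  rw [hn, Nat.cast_pow, show ((2 : ℕ) : ZMod 2) = 0 from by decide, zero_pow n.ne_zero]

/-- The weight on the affine points `span{(w, x, y, 1)}` attached to `a`. -/
def weight (a w x y : k) : ZMod 2 :=
  (if x = a ∧ y ≠ 0 then 1 else 0) + if x * w = a * (w + x * y) then 1 else 0

theorem sum_weight_of_slope [CharP k 2] (a w y m : k) :
    ∑ s, weight a (w + s * y) s (y + s * m) = if w ≠ 0 then 1 else 0 := by
  have h2 : (2 : k) = 0 := CharTwo.two_eq_zero
  have h1 : ∑ s : k, (if s = a ∧ y + s * m ≠ 0 then (1 : ZMod 2) else 0) =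
      if y + a * m ≠ 0 then 1 else 0 := by
    rw [Finset.sum_eq_single a]
    · simp
    · intro s _ hs
      simp [hs]
    · simp
  have h3 : ∀ s : k, (s * (w + s * y) = a * (w + s * y + s * (y + s * m))) ↔
      s * s * (y + a * m) + s * w + a * w = 0 := by
    intro s
    constructor <;> intro h
    · linear_combination h + (a * s * y + a * s * s * m + a * w) * h2
    · linear_combination h - (a * s * y + a * s * s * m + a * w) * h2
  simp only [weight, Finset.sum_add_distrib, h1, h3]
  by_cases hA : y + a * m = 0
  · by_cases hw : w = 0
    · simp [hA, hw, natCast_card_eq_zero]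
    · rw [Finset.sum_eq_single a]
      · have : a * w + a * w = 0 := CharTwo.add_self_eq_zero _
        simp [hA, hw, this]
      · intro s _ hs
        rw [if_neg]
        intro h
        rw [hA] at h
        have h4 : (s - a) * w = 0 := by linear_combination h - a * w * h2
        rcases mul_eq_zero.mp h4 with h5 | h5
        · exact hs (sub_eq_zero.mp h5)
        · exact hw h5
      · simp
  · by_cases hw : w = 0
    · subst hw
      simp [hA]
      decide
    · rw [sum_eq_zero_of_involution _ (fun s => s + w / (y + a * m))]
      · simp [hA, hw]
      · intro s
        rw [add_assoc, CharTwo.add_self_eq_zero, add_zero]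
      · intro s
        simp [hA, hw]
      · intro s
        have : (s + w / (y + a * m)) * (s + w / (y + a * m)) * (y + a * m) +
            (s + w / (y + a * m)) * w + a * w = s * s * (y + a * m) + s * w + a * w := by
          field_simp
          linear_combination (s * w * (y + a * m) + w ^ 2) * h2
        simp only [this]

theorem sum_weight_of_vertical [CharP k 2] (a w x : k) :
    ∑ s, weight a (w + s * x) x s =
      (if x = a then 1 else 0) + if x ≠ 0 then 1 else 0 := by
  have h2 : (2 : k) = 0 := CharTwo.two_eq_zero
  have hc : ∑ s : k, (if s ≠ 0 then (1 : ZMod 2) else 0) = 1 := by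
    have h : ∀ s : k, (if s ≠ 0 then (1 : ZMod 2) else 0) = 1 + if s = 0 then 1 else 0 := by
      intro s
      by_cases hs : s = 0 <;> simp [hs]
      decide
    simp only [h, Finset.sum_add_distrib]
    simp [natCast_card_eq_zero]
  have h1 : ∑ s : k, (if x = a ∧ s ≠ 0 then (1 : ZMod 2) else 0) = if x = a then 1 else 0 := by
    by_cases hx : x = a
    · simpa [hx] using hc
    · simp [hx]
  have h3 : ∀ s : k, (x * (w + s * x) = a * (w + s * x + x * s)) ↔
      x * x * s = a * w - x * w := by
    intro s
    constructor <;> intro h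
    · linear_combination h + a * s * x * h2
    · linear_combination h - a * s * x * h2
  simp only [weight, Finset.sum_add_distrib, h1, h3]
  congr 1
  by_cases hx : x = 0
  · by_cases haw : a * w = 0 <;> simp [hx, natCast_card_eq_zero, eq_comm, haw]
  · have h4 : ∀ s : k, (x * x * s = a * w - x * w) ↔ s = (a * w - x * w) / (x * x) := by
      intro s
      field_simp
    simp [h4, hx]

theorem IsLn.exists_mem_ne_zero {l : Submodule k (Fin 4 → k)} (hl : IsLn k l) (i : Fin 4) :
    ∃ d ∈ l, d ≠ 0 ∧ d i = 0 := by
  by_contra! h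
  have hinj : Function.Injective ((LinearMap.proj i : (Fin 4 → k) →ₗ[k] k).comp l.subtype) := by
    rw [← LinearMap.ker_eq_bot, LinearMap.ker_eq_bot']
    intro v hv
    by_contra hne
    exact h v v.2 (by simpa using hne) hv
  have := LinearMap.finrank_le_finrank_of_injective hinj
  rw [hl.1, finrank_self] at this
  omega

theorem IsLn.mem_iff {l : Submodule k (Fin 4 → k)} (hl : IsLn k l) {v d : Fin 4 → k}
    (hv : v ∈ l) (hd : d ∈ l) (hli : LinearIndependent k ![v, d]) (u : Fin 4 → k) :
    u ∈ l ↔ ∃ a b : k, a • v + b • d = u := by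
  have hle : span k {v, d} ≤ l := by
    rw [span_le]
    rintro x (rfl | rfl) <;> assumption
  have hfr : finrank k (span k {v, d}) = 2 := by
    have := finrank_span_eq_card hli
    rwa [Matrix.range_cons_cons_empty] at this
  rw [← eq_of_le_of_finrank_eq hle (hfr.trans hl.1.symm), mem_span_pair]

theorem IsLn.p0_or_slope_or_vertical [CharP k 2] {l : Submodule k (Fin 4 → k)} (hl : IsLn k l) :
    ((∀ u ∈ l, u 3 = 0) ∧ e k 0 ∈ l) ∨
    (∃ w y m : k, ∀ u : Fin 4 → k,
      u ∈ l ↔ u 0 = u 3 * w + u 1 * y ∧ u 2 = u 3 * y + u 1 * m) ∨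
    (∃ w x : k, ∀ u : Fin 4 → k, u ∈ l ↔ u 0 = u 3 * w + u 2 * x ∧ u 1 = u 3 * x) := by
  have h2 : (2 : k) = 0 := CharTwo.two_eq_zero
  by_cases h3 : ∀ u ∈ l, u 3 = 0
  · refine Or.inl ⟨h3, ?_⟩
    obtain ⟨d, hd, hd0, hd1⟩ := hl.exists_mem_ne_zero 1
    obtain ⟨f, hf, hf0, hf1⟩ := hl.exists_mem_ne_zero 2
    have key : ∀ v ∈ l, v ≠ 0 → v 1 = 0 → v 2 = 0 → e k 0 ∈ l := by
      intro v hv hv0 hv1 hv2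
      have hv3 := h3 v hv
      have hne : v 0 ≠ 0 := by
        intro h
        apply hv0
        ext i
        fin_cases i <;> simpa
      have : e k 0 = (v 0)⁻¹ • v := by
        ext i
        fin_cases i <;> simp [e, hne, hv1, hv2, hv3]
      rw [this]
      exact l.smul_mem _ hv
    have hB := hl.2 d hd f hf
    simp only [B, h3 d hd, h3 f hf, hd1, hf1] at hB
    have hB' : d 2 * f 1 = 0 := by linear_combination -hB
    rcases mul_eq_zero.mp hB' with h | h
    · exact key d hd hd0 hd1 h
    · exact key f hf hf0 h hf1
  · push Not at h3
    obtain ⟨v, hv, hv3⟩ := h3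
    obtain ⟨d, hd, hd0, hd3⟩ := hl.exists_mem_ne_zero 3
    have hB := hl.2 v hv d hd
    simp only [B, hd3] at hB
    have hli : LinearIndependent k ![v, d] := by
      rw [LinearIndependent.pair_iff]
      intro s t hst
      have hs : s = 0 := by
        have := congrFun hst 3
        simpa [hd3, hv3] using this
      subst hs
      simpa [hd0] using hst
    have hmem := hl.mem_iff hv hd hli
    right
    by_cases hd1 : d 1 = 0
    · right
      have hd2 : d 2 ≠ 0 := by
        intro hd2
        apply hd0
        ext i
        fin_cases i
        · have : v 3 * d 0 = 0 := by linear_combination -hB + v 1 * hd2 - v 2 * hd1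
          simpa [hv3] using this
        all_goals simpa
      have hx : v 3 * d 0 = v 1 * d 2 := by linear_combination -hB - v 2 * hd1
      refine ⟨v 0 / v 3 - v 1 * v 2 / (v 3 * v 3), v 1 / v 3, fun u => ?_⟩
      rw [hmem]
      constructor
      · rintro ⟨a, b, rfl⟩
        simp only [Pi.add_apply, Pi.smul_apply, smul_eq_mul, hd3, hd1]
        constructor
        · field_simp
          linear_combination v 3 * b * hx
        · field_simp
          ring
      · rintro ⟨hu0, hu1⟩
        refine ⟨u 3 / v 3, (u 2 - u 3 / v 3 * v 2) / d 2, ?_⟩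
        have hd0' : d 0 = v 1 * d 2 / v 3 := by field_simp; linear_combination hx
        ext i
        fin_cases i
        · simp [hu0, hd0']
          field_simp
          ring
        · simp [hu1, hd1]
          field_simp
        · simp
          field_simp
          ring
        · simp [hd3, hv3]
    · left
      have hx : v 3 * d 0 = v 1 * d 2 + v 2 * d 1 := by
        linear_combination -hB - v 2 * d 1 * h2
      refine ⟨v 0 / v 3 - v 1 * d 0 / (v 3 * d 1), d 0 / d 1, d 2 / d 1, fun u => ?_⟩
      have hd0' : d 0 = (v 1 * d 2 + v 2 * d 1) / v 3 := by field_simp; linear_combination hx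
      rw [hmem]
      constructor
      · rintro ⟨a, b, rfl⟩
        simp only [Pi.add_apply, Pi.smul_apply, smul_eq_mul, hd3]
        constructor
        · field_simp
          ring
        · rw [hd0']
          field_simp
          linear_combination -a * v 1 * d 2 * v 3 * h2
      · rintro ⟨hu0, hu2⟩
        refine ⟨u 3 / v 3, (u 1 - u 3 / v 3 * v 1) / d 1, ?_⟩
        ext i
        fin_cases i
        · simp [hu0]
          field_simp
          ring
        · simp
          field_simp
          ring
        · simp [hu2]
          rw [hd0']
          field_simp
          linear_combination -u 3 * v 1 * d 2 * h2
        · simp [hd3, hv3]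

/-- The indicator of a subspace, as a function on vectors. -/
def ind (l : Submodule k (Fin 4 → k)) (v : Fin 4 → k) : ZMod 2 := if v ∈ l then 1 else 0

theorem sum_weight_mul_ind [CharP k 2] {l : Submodule k (Fin 4 → k)} (hl : IsLn k l) (a b : k) :
    ∑ w, ∑ x, ∑ y, (weight a w x y + weight b w x y) * ind l ![w, x, y, 1] +
      ind l ![a, 0, 1, 0] + ind l ![b, 0, 1, 0] = 0 := by
  rcases hl.p0_or_slope_or_vertical with ⟨h3, h0⟩ | ⟨w, y, m, h⟩ | ⟨w, x, h⟩
  · have haff : ∀ w x y : k, ind l ![w, x, y, 1] = 0 := fun w x y =>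
      if_neg fun hm => one_ne_zero (α := k) (h3 _ hm)
    have hab : ind l ![a, 0, 1, 0] = ind l ![b, 0, 1, 0] := by
      have : (![a, 0, 1, 0] : Fin 4 → k) = ![b, 0, 1, 0] + (a - b) • e k 0 := by
        ext i
        fin_cases i <;> simp [e]
      unfold ind
      rw [this, l.add_mem_iff_left (l.smul_mem _ h0)]
    simp [haff, hab, CharTwo.add_self_eq_zero]
  · have hinf : ∀ a : k, ind l ![a, 0, 1, 0] = 0 := fun a => if_neg fun hm => by
      simpa using ((h _).1 hm).2
    have haff : ∀ w' x y' : k, ind l ![w', x, y', 1] =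
        if y' = y + x * m then if w' = w + x * y then 1 else 0 else 0 := by
      intro w' x y'
      by_cases h1 : y' = y + x * m <;> by_cases h2 : w' = w + x * y <;> simp [ind, h, h1, h2]
    rw [hinf, hinf, Finset.sum_comm]
    simp only [haff, mul_ite, mul_zero, mul_one, Finset.sum_ite_eq',
      Finset.mem_univ, if_true, Finset.sum_add_distrib, sum_weight_of_slope,
      CharTwo.add_self_eq_zero]
  · have hinf : ∀ a : k, ind l ![a, 0, 1, 0] = if x = a then 1 else 0 := by
      intro a
      simp only [ind, h]
      simp [eq_comm]
    have haff : ∀ w' x' y : k, ind l ![w', x', y, 1] =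
        if w' = w + y * x then if x' = x then 1 else 0 else 0 := by
      intro w' x' y
      simp only [ind, h]
      simp [ite_and]
    have hrw : ∑ w', ∑ x', ∑ y, (weight a w' x' y + weight b w' x' y) * ind l ![w', x', y, 1] =
        ∑ y, (weight a (w + y * x) x y + weight b (w + y * x) x y) := by
      rw [Finset.sum_congr rfl fun w' _ => Finset.sum_comm, Finset.sum_comm]
      simp only [haff, mul_ite, mul_zero, mul_one, Finset.sum_ite_eq', Finset.sum_ite_irrel,
        Finset.sum_const_zero, Finset.mem_univ, if_true]
    rw [hrw, Finset.sum_add_distrib, sum_weight_of_vertical, sum_weight_of_vertical, hinf, hinf]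
    generalize (if x = a then (1 : ZMod 2) else 0) = A
    generalize (if x = b then (1 : ZMod 2) else 0) = C
    generalize (if x ≠ 0 then (1 : ZMod 2) else 0) = D
    revert A C D
    decide

theorem isPt_span_singleton_ite (v : Fin 4 → k) :
    IsPt k (span k {if v = 0 then e k 0 else v}) := by
  refine finrank_span_singleton ?_
  split_ifs with h
  · simp [e]
  · exact h

/-- The point spanned by a nonzero vector (and `p0` for the zero vector). -/
def ptOf (v : Fin 4 → k) : Pt k :=
  ⟨span k {if v = 0 then e k 0 else v}, isPt_span_singleton_ite v⟩

theorem coe_ptOf {v : Fin 4 → k} (hv : v ≠ 0) : (ptOf v : Submodule k (Fin 4 → k)) = span k {v} := by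
  simp [ptOf, hv]

theorem ptOf_smul {v : Fin 4 → k} (hv : v ≠ 0) {s : k} (hs : s ≠ 0) : ptOf (s • v) = ptOf v := by
  apply Subtype.ext
  rw [coe_ptOf hv, coe_ptOf (smul_ne_zero hs hv), span_singleton_smul_eq hs.isUnit]

theorem exists_ptOf_eq (p : Pt k) : ∃ v : Fin 4 → k, v ≠ 0 ∧ ptOf v = p := by
  obtain ⟨v, hv, h⟩ := finrank_eq_one_iff'.1 p.2
  have hv' : (v : Fin 4 → k) ≠ 0 := by simpa using hv
  refine ⟨v, hv', Subtype.ext ?_⟩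
  rw [coe_ptOf hv']
  apply le_antisymm
  · rw [span_singleton_le_iff_mem]
    exact v.2
  · intro u hu
    obtain ⟨s, hs⟩ := h ⟨u, hu⟩
    exact mem_span_singleton.2 ⟨s, congrArg Subtype.val hs⟩

theorem chi_ptOf (l : Submodule k (Fin 4 → k)) {v : Fin 4 → k} (hv : v ≠ 0) :
    chi k l (ptOf v) = ind l v := by
  unfold chi ind
  rw [coe_ptOf hv]
  simp only [span_singleton_le_iff_mem]

theorem inP1_ptOf {v : Fin 4 → k} (hv : v ≠ 0) : InP1 k (ptOf v) ↔ v 3 ≠ 0 := by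
  unfold InP1
  rw [coe_ptOf hv]
  have hB : ∀ u : Fin 4 → k, B k (e k 0) u = u 3 := fun u => by simp [B, e]
  simp only [hB]
  constructor
  · rintro ⟨u, hu, hu3⟩ h
    obtain ⟨s, rfl⟩ := mem_span_singleton.1 hu
    simp [h] at hu3
  · exact fun h => ⟨v, mem_span_singleton_self v, h⟩

/-- The linear map acting on the two middle coordinates by a `2 × 2` matrix. -/
def midMap (α β γ δ : k) : (Fin 4 → k) →ₗ[k] (Fin 4 → k) where
  toFun v := ![v 0, α * v 1 + γ * v 2, β * v 1 + δ * v 2, v 3]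
  map_add' u v := by
    ext i
    fin_cases i <;> simp <;> ring
  map_smul' s v := by
    ext i
    fin_cases i <;> simp <;> ring

theorem midMap_apply (α β γ δ : k) (v : Fin 4 → k) :
    midMap α β γ δ v = ![v 0, α * v 1 + γ * v 2, β * v 1 + δ * v 2, v 3] := rfl

theorem midMap_injective {α β γ δ : k} (h : α * δ - β * γ = 1) :
    Function.Injective (midMap α β γ δ) := by
  rw [← LinearMap.ker_eq_bot, LinearMap.ker_eq_bot']
  intro v hv
  rw [midMap_apply] at hv
  have h0 := congrFun hv 0
  have h1 := congrFun hv 1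
  have h2 := congrFun hv 2
  have h3 := congrFun hv 3
  simp at h0 h1 h2 h3
  ext i
  fin_cases i
  · exact h0
  · change v 1 = 0
    linear_combination δ * h1 - γ * h2 - v 1 * h
  · change v 2 = 0
    linear_combination α * h2 - β * h1 - v 2 * h
  · exact h3

theorem IsLn.comap_midMap {l : Submodule k (Fin 4 → k)} (hl : IsLn k l) {α β γ δ : k}
    (h : α * δ - β * γ = 1) : IsLn k (l.comap (midMap α β γ δ)) := by
  constructor
  · let g := LinearEquiv.ofInjectiveEndo (midMap α β γ δ) (midMap_injective h)
    have hg : l.comap (midMap α β γ δ) = l.map (g.symm : (Fin 4 → k) →ₗ[k] (Fin 4 → k)) := by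
      rw [Submodule.map_equiv_eq_comap_symm]
      rfl
    rw [hg, LinearEquiv.finrank_map_eq]
    exact hl.1
  · intro u hu v hv
    have hB := hl.2 _ hu _ hv
    rw [midMap_apply, midMap_apply] at hB
    simp [B] at hB ⊢
    linear_combination hB - (u 1 * v 2 - u 2 * v 1) * h

theorem sum_weight_mul_eq_zero [CharP k 2] {c : Pt k → ZMod 2} (hc : c ∈ CPL k)
    {α β γ δ : k} (h : α * δ - β * γ = 1) (a b : k) :
    ∑ w, ∑ x, ∑ y, (weight a w x y + weight b w x y) *
        c (ptOf (midMap α β γ δ ![w, x, y, 1])) +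
      c (ptOf (midMap α β γ δ ![a, 0, 1, 0])) + c (ptOf (midMap α β γ δ ![b, 0, 1, 0])) = 0 := by
  induction hc using Submodule.span_induction with
  | mem c hc =>
    obtain ⟨l, hl, rfl⟩ := hc
    have hne : ∀ v : Fin 4 → k, v ≠ 0 → midMap α β γ δ v ≠ 0 := fun v hv h0 =>
      hv (midMap_injective h (h0.trans (map_zero _).symm))
    have hchi : ∀ v : Fin 4 → k, v ≠ 0 →
        chi k l (ptOf (midMap α β γ δ v)) = ind (l.comap (midMap α β γ δ)) v := fun v hv =>
      chi_ptOf l (hne v hv)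
    have h1 : ∀ w x y : k, (![w, x, y, 1] : Fin 4 → k) ≠ 0 := fun w x y h0 => by
      simpa using congrFun h0 3
    have h2 : ∀ a : k, (![a, 0, 1, 0] : Fin 4 → k) ≠ 0 := fun a h0 => by
      simpa using congrFun h0 2
    simp only [hchi _ (h1 _ _ _), hchi _ (h2 _)]
    exact sum_weight_mul_ind (hl.comap_midMap h) a b
  | zero => simp
  | add c d _ _ hc hd =>
    simp only [Pi.add_apply, mul_add, Finset.sum_add_distrib] at hc hd ⊢
    linear_combination hc + hd
  | smul s c _ hc =>
    simp only [Pi.smul_apply, smul_eq_mul, mul_left_comm _ s, ← Finset.mul_sum] at hc ⊢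
    linear_combination s * hc

theorem sum_off_perp_eq_zero [CharP k 2] {c : Pt k → ZMod 2} (hc : c ∈ CPL k) :
    ∑ u : Fin 3 → k, c (ptOf (Fin.cons 1 u : Fin 4 → k)) = 0 := by
  induction hc using Submodule.span_induction with
  | mem c hc =>
    obtain ⟨l, hl, rfl⟩ := hc
    obtain ⟨d, hd, hd0, hd1⟩ := hl.exists_mem_ne_zero 0
    have hne : ∀ u : Fin 3 → k, (Fin.cons 1 u : Fin 4 → k) ≠ 0 := fun u h0 => by
      simpa using congrFun h0 0
    have hcons : ∀ u : Fin 3 → k,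
        (Fin.cons 1 (u + Fin.tail d) : Fin 4 → k) = Fin.cons 1 u + d := by
      intro u
      ext i
      refine Fin.cases ?_ (fun j => ?_) i
      · simp [hd1]
      · simp [Fin.tail]
    simp only [chi_ptOf l (hne _)]
    refine sum_eq_zero_of_involution _ (fun u => u + Fin.tail d) ?_ ?_ ?_
    · intro u
      ext j
      simp [add_assoc, CharTwo.add_self_eq_zero]
    · intro u hu
      apply hd0
      ext i
      refine Fin.cases hd1 (fun j => ?_) i
      simpa [Fin.tail] using congrFun hu j
    · intro u
      simp only [ind, hcons, l.add_mem_iff_left hd]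
  | zero => simp
  | add c d _ _ hc hd => simp [Finset.sum_add_distrib, hc, hd]
  | smul s c _ hc => simp [← Finset.mul_sum, hc]

/-- Representatives of the points of `p0^⊥ / p0`. -/
def rep : Option k → (Fin 4 → k)
  | none => ![0, 0, 1, 0]
  | some m => ![0, 1, m, 0]

theorem rep_ne_zero (j : Option k) : rep j ≠ 0 := by
  intro h
  cases j with
  | none => simpa [rep] using congrFun h 2
  | some m => simpa [rep] using congrFun h 1

theorem mem_ker_piP1 {c : Pt k → ZMod 2} :
    c ∈ LinearMap.ker (piP1 k) ↔ ∀ p, InP1 k p → c p = 0 := by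
  rw [LinearMap.mem_ker]
  constructor
  · exact fun h p hp => congrFun h ⟨p, hp⟩
  · exact fun h => funext fun p => h p p.2

theorem apply_ptOf_add_smul [CharP k 2] {c : Pt k → ZMod 2} (hc : c ∈ CPL k)
    (hker : ∀ p, InP1 k p → c p = 0) (j : Option k) (a : k) :
    c (ptOf (rep j + a • e k 0)) = c (ptOf (rep j)) := by
  have key : ∀ α β γ δ : k, α * δ - β * γ = 1 →
      c (ptOf ![a, γ, δ, 0]) = c (ptOf ![0, γ, δ, 0]) := by
    intro α β γ δ h
    have hsum := sum_weight_mul_eq_zero hc h a 0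
    have haff : ∀ w x y : k, c (ptOf (midMap α β γ δ ![w, x, y, 1])) = 0 := by
      intro w x y
      apply hker
      rw [inP1_ptOf]
      · simp [midMap_apply]
      · intro h0
        simpa [midMap_apply] using congrFun h0 3
    simp only [haff, mul_zero, Finset.sum_const_zero, zero_add] at hsum
    simpa [midMap_apply] using CharTwo.add_eq_zero.1 hsum
  cases j with
  | none =>
    have := key 1 0 0 1 (by ring)
    convert this using 3
    · ext i
      fin_cases i <;> simp [rep, e]
    · rfl
  | some m =>
    have := key 0 1 1 m (by linear_combination -CharTwo.two_eq_zero (R := k))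
    convert this using 3
    · ext i
      fin_cases i <;> simp [rep, e]
    · rfl

theorem eq_zero_of_apply_rep [CharP k 2] {c : Pt k → ZMod 2} (hc : c ∈ CPL k)
    (hker : ∀ p, InP1 k p → c p = 0) (hrep : ∀ j, c (ptOf (rep j)) = 0) : c = 0 := by
  have hne : ∀ v : Fin 4 → k, v 1 ≠ 0 ∨ v 2 ≠ 0 ∨ v 3 ≠ 0 → c (ptOf v) = 0 := by
    intro v hv
    have hv0 : v ≠ 0 := by
      rintro rfl
      simp at hv
    by_cases h3 : v 3 = 0
    · have key : ∀ (s : k) (j : Option k) (a : k), s ≠ 0 → s • v = rep j + a • e k 0 →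
          c (ptOf v) = 0 := by
        intro s j a hs hv
        rw [← ptOf_smul hv0 hs, hv, apply_ptOf_add_smul hc hker, hrep]
      by_cases h1 : v 1 = 0
      · have h2 : v 2 ≠ 0 := by simpa [h1, h3] using hv
        refine key (v 2)⁻¹ none (v 0 / v 2) (inv_ne_zero h2) ?_
        ext i
        fin_cases i <;> simp [rep, e, h1, h2, h3, div_eq_inv_mul]
      · refine key (v 1)⁻¹ (some (v 2 / v 1)) (v 0 / v 1) (inv_ne_zero h1) ?_
        ext i
        fin_cases i <;> simp [rep, e, h1, h3, div_eq_inv_mul]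
    · exact hker _ ((inP1_ptOf hv0).2 h3)
  have hp0 : c (ptOf (e k 0)) = 0 := by
    have hsum := sum_off_perp_eq_zero hc
    rw [Finset.sum_eq_single 0] at hsum
    · convert hsum using 3
      ext i
      refine Fin.cases ?_ (fun j => ?_) i <;> simp [e]
    · intro u _ hu
      apply hne
      by_contra! h
      apply hu
      ext i
      fin_cases i
      · exact h.1
      · exact h.2.1
      · exact h.2.2
    · simp
  funext p
  obtain ⟨v, hv, rfl⟩ := exists_ptOf_eq p
  by_cases h : v 1 ≠ 0 ∨ v 2 ≠ 0 ∨ v 3 ≠ 0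
  · exact hne v h
  · push Not at h
    have h0 : v 0 ≠ 0 := by
      intro h0
      apply hv
      ext i
      fin_cases i
      · exact h0
      · exact h.1
      · exact h.2.1
      · exact h.2.2
    have hve : v = v 0 • e k 0 := by
      ext i
      fin_cases i <;> simp [e, h]
    rw [hve, ptOf_smul (by simp [e]) h0, hp0]
    rfl

/-- The line through `p0` and the point spanned by `rep j`. -/
def pencil (j : Option k) : Submodule k (Fin 4 → k) := span k {e k 0, rep j}

theorem isLn_pencil (j : Option k) : IsLn k (pencil j) := by
  constructor
  · have hli : LinearIndependent k ![e k 0, rep j] := by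
      rw [LinearIndependent.pair_iff]
      intro s t h
      have h0 := congrFun h 0
      have h1 := congrFun h 1
      have h2 := congrFun h 2
      cases j <;> simp_all [rep, e]
    have := finrank_span_eq_card hli
    rwa [Matrix.range_cons_cons_empty] at this
  · intro u hu v hv
    obtain ⟨a, b, rfl⟩ := mem_span_pair.1 hu
    obtain ⟨a', b', rfl⟩ := mem_span_pair.1 hv
    cases j <;> simp [B, e, rep] <;> ring

theorem chi_pencil_rep (i j : Option k) :
    chi k (pencil i) (ptOf (rep j)) = if i = j then 1 else 0 := by
  rw [chi_ptOf _ (rep_ne_zero j), ind]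
  congr 1
  rw [pencil, mem_span_pair, eq_iff_iff]
  constructor
  · rintro ⟨a, b, h⟩
    have h1 := congrFun h 1
    have h2 := congrFun h 2
    cases i <;> cases j <;> simp_all [rep, e]
  · rintro rfl
    exact ⟨0, 1, by simp⟩

theorem chi_pencil_mem (j : Option k) :
    chi k (pencil j) ∈ CPL k ⊓ LinearMap.ker (piP1 k) := by
  refine ⟨subset_span ⟨_, isLn_pencil j, rfl⟩, mem_ker_piP1.2 fun p hp => ?_⟩
  obtain ⟨v, hv, rfl⟩ := exists_ptOf_eq p
  rw [inP1_ptOf hv] at hp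
  rw [chi_ptOf _ hv, ind, if_neg]
  intro h
  obtain ⟨a, b, rfl⟩ := mem_span_pair.1 h
  cases j <;> simp [rep, e] at hp

/-- Evaluation of a codeword vanishing on `P1` at the points spanned by the `rep j`. -/
def evalRep : ↥(CPL k ⊓ LinearMap.ker (piP1 k)) →ₗ[ZMod 2] (Option k → ZMod 2) :=
  (LinearMap.funLeft (ZMod 2) (ZMod 2) fun j => ptOf (rep j)).comp (Submodule.subtype _)

theorem evalRep_apply (c : ↥(CPL k ⊓ LinearMap.ker (piP1 k))) (j : Option k) :
    evalRep c j = (c : Pt k → ZMod 2) (ptOf (rep j)) := rfl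

theorem evalRep_bijective [CharP k 2] : Function.Bijective (evalRep (k := k)) := by
  constructor
  · rw [← LinearMap.ker_eq_bot, LinearMap.ker_eq_bot']
    rintro ⟨c, hc⟩ h
    exact Subtype.ext (eq_zero_of_apply_rep hc.1 (mem_ker_piP1.1 hc.2) fun j => congrFun h j)
  · intro f
    refine ⟨∑ i, f i • ⟨chi k (pencil i), chi_pencil_mem i⟩, ?_⟩
    ext j
    simp [evalRep_apply, chi_pencil_rep, -Fintype.sum_option]

variable (k)

theorem dim_ker_inter_CPL (t : ℕ) (ht : 0 < t) (q : ℕ) (hq : q = 2 ^ t)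
    (hcard : Fintype.card k = q) :
    finrank (ZMod 2) ↥(CPL k ⊓ LinearMap.ker (piP1 k)) = q + 1 := by
  have : CharP k 2 := charP_of_card_eq_prime_pow (hcard.trans hq)
  rw [(LinearEquiv.ofBijective evalRep evalRep_bijective).finrank_eq, finrank_fintype_fun_eq_card,
    Fintype.card_option, hcard]
end
end
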